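/- Let G be a connected graph such that J_G is unmixed and, for each block B of G, the block with whiskers B̄ is accessible. Then G is accessible. -/

import Mathlib

open SimpleGraph

universe u u'

/-- The number of connected components of the induced subgraph of `G` on the vertex set `A`. -/
noncomputable def cComp {V : Type u} (G : SimpleGraph V) (A : Set V) : ℕ :=
  Nat.card (G.induce A).ConnectedComponent

/-- `x` is a cut vertex of the induced subgraph of `G` on `A`: removing `x`
increases the number of connected components. -/
def CutVertexOn {V : Type u} (G : SimpleGraph V) (A : Set V) (x : V) : Prop :=
  x ∈ A ∧ cComp G A < cComp G (A \ {x})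

/-- `T` is a cutset of the induced subgraph of `G` on `A`: every `t ∈ T` is a
cut vertex of `G[A] ∖ (T ∖ {t})`. -/
def CutsetOn {V : Type u} [DecidableEq V] (G : SimpleGraph V) (A : Set V) (T : Finset V) :
    Prop :=
  ↑T ⊆ A ∧ ∀ t ∈ T, CutVertexOn G (A \ ↑(T.erase t)) t

/-- The binomial edge ideal of the induced subgraph of `G` on `A` is unmixed
(combinatorial characterization): `c(T) = |T| + c(∅)` for every cutset `T`. -/
def UnmixedOn {V : Type u} [DecidableEq V] (G : SimpleGraph V) (A : Set V) : Prop :=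
  ∀ T : Finset V, CutsetOn G A T → cComp G (A \ ↑T) = T.card + cComp G A

/-- The induced subgraph of `G` on `A` is accessible. -/
def AccessibleOn {V : Type u} [DecidableEq V] (G : SimpleGraph V) (A : Set V) : Prop :=
  UnmixedOn G A ∧
    ∀ T : Finset V, CutsetOn G A T → T.Nonempty → ∃ t ∈ T, CutsetOn G A (T.erase t)

/-- The graph `(G[A])_x`: add all edges between neighbours of `x` lying in `A`. -/
def cliqueAtOn {V : Type u} (G : SimpleGraph V) (A : Set V) (x : V) : SimpleGraph V :=
  G ⊔ SimpleGraph.fromRel (fun a b => a ∈ A ∧ b ∈ A ∧ G.Adj x a ∧ G.Adj x b)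

/-- The binomial edge ideal of the induced subgraph of `G` on `A` is strongly unmixed. -/
inductive StronglyUnmixedOn {V : Type u} [DecidableEq V] : SimpleGraph V → Set V → Prop
  | complete (G : SimpleGraph V) (A : Set V)
      (h : ∀ a b : A, (G.induce A).Reachable a b → a ≠ b → (G.induce A).Adj a b) :
      StronglyUnmixedOn G A
  | cut (G : SimpleGraph V) (A : Set V) (hU : UnmixedOn G A) (x : V)
      (hx : CutVertexOn G A x)
      (h1 : StronglyUnmixedOn G (A \ {x}))
      (h2 : StronglyUnmixedOn (cliqueAtOn G A x) A)
      (h3 : StronglyUnmixedOn (cliqueAtOn G A x) (A \ {x})) :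
      StronglyUnmixedOn G A

/-- `x` is a free vertex of `G`: the induced subgraph on `N(x) ∪ {x}` is complete. -/
def FreeVertex {V : Type u} (G : SimpleGraph V) (x : V) : Prop :=
  ∀ a b : V, G.Adj x a → G.Adj x b → a ≠ b → G.Adj a b

/-- Attach a whisker (pendant vertex) at each vertex of `Wv`.  `Sum.inl a` is the
original vertex `a` and `Sum.inr x` is the whisker vertex `f_x` attached at `x ∈ Wv`. -/
def whiskered {V : Type u} (G : SimpleGraph V) (Wv : Set V) : SimpleGraph (V ⊕ V) :=
  SimpleGraph.fromRel (fun a b =>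
    (∃ x y, G.Adj x y ∧ a = Sum.inl x ∧ b = Sum.inl y) ∨
    (∃ x ∈ Wv, a = Sum.inl x ∧ b = Sum.inr x))

/-- `B` is (the vertex set of) a block of `G`: a maximal connected induced
subgraph having no cut vertex. -/
def IsBlock {V : Type u} (G : SimpleGraph V) (B : Set V) : Prop :=
  (G.induce B).Connected ∧ (∀ x, ¬ CutVertexOn G B x) ∧
    ∀ B' : Set V, B ⊆ B' → (G.induce B').Connected → (∀ x, ¬ CutVertexOn G B' x) → B' = B

/-- Glue two graphs `G` and `H`, identifying the vertex `x` of `G` with the vertex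
`y` of `H` (the identified vertex is `Sum.inl x`). -/
def glueAt {V : Type u} {W : Type u'} (G : SimpleGraph V) (H : SimpleGraph W) (x : V) (y : W) :
    SimpleGraph (V ⊕ W) :=
  SimpleGraph.fromRel (fun a b =>
    (∃ p q, G.Adj p q ∧ a = Sum.inl p ∧ b = Sum.inl q) ∨
    (∃ p q, H.Adj p q ∧ p ≠ y ∧ q ≠ y ∧ a = Sum.inr p ∧ b = Sum.inr q) ∨
    (∃ q, H.Adj y q ∧ a = Sum.inl x ∧ b = Sum.inr q))

/-- The star product `K_m ⋆_r K_n`: two complete graphs, on `{x₁,…,x_m}` (the `inl`s)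
and `{y₁,…,y_n}` (the `inr`s), together with the matching edges `{x_i, y_i}` for `1 ≤ i ≤ r`
(indices `0,…,r-1` here). -/
def starProd (m n r : ℕ) : SimpleGraph (Fin m ⊕ Fin n) :=
  SimpleGraph.fromRel (fun a b =>
    (∃ x y : Fin m, a = Sum.inl x ∧ b = Sum.inl y) ∨
    (∃ x y : Fin n, a = Sum.inr x ∧ b = Sum.inr y) ∨
    (∃ (x : Fin m) (y : Fin n), (x : ℕ) = (y : ℕ) ∧ (x : ℕ) < r ∧
      a = Sum.inl x ∧ b = Sum.inr y))

/-- The vertices `x_i, y_i` for `2 ≤ i ≤ r` (indices `1,…,r-1` here), at which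
whiskers are attached to form `overline(K_m ⋆_r K_n)`. -/
def starWhisk (m n r : ℕ) : Set (Fin m ⊕ Fin n) :=
  {a | (∃ x : Fin m, a = Sum.inl x ∧ 1 ≤ (x : ℕ) ∧ (x : ℕ) < r) ∨
       (∃ y : Fin n, a = Sum.inr y ∧ 1 ≤ (y : ℕ) ∧ (y : ℕ) < r)}

/-- `a` and `b` both lie in `A` and are joined by a path of the induced subgraph of `G` on `A`. -/
def ReachIn {V : Type u} (G : SimpleGraph V) (A : Set V) (a b : V) : Prop :=
  ∃ (ha : a ∈ A) (hb : b ∈ A), (G.induce A).Reachable ⟨a, ha⟩ ⟨b, hb⟩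

/-- Auxiliary (connected case): `G[A]` has no cut vertex, or for every cut vertex `x`,
every connected component of `G[A] ∖ {x}` contains at most `r` cut vertices of `G[A] ∖ {x}`. -/
def RCutConnAux {V : Type u} (G : SimpleGraph V) (A : Set V) (r : ℕ) : Prop :=
  (∀ x, ¬ CutVertexOn G A x) ∨
    ∀ x, CutVertexOn G A x → ∀ a ∈ A \ {x},
      Set.ncard {w | CutVertexOn G (A \ {x}) w ∧ ReachIn G (A \ {x}) a w} ≤ r

/-- `G[A]` is `r`-cut-connected: every connected component of `G[A]` satisfies the
condition of `RCutConnAux`. -/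
def RCutConn {V : Type u} (G : SimpleGraph V) (A : Set V) (r : ℕ) : Prop :=
  ∀ a ∈ A, RCutConnAux G {b | ReachIn G A a b} r

/-- `G[A]` is strongly `r`-cut-connected: it is `r`-cut-connected and, recursively,
`G[A] ∖ {x}` is strongly `r`-cut-connected for every cut vertex `x`. -/
inductive StronglyRCutConn {V : Type u} (r : ℕ) : SimpleGraph V → Set V → Prop
  | mk (G : SimpleGraph V) (A : Set V) (h1 : RCutConn G A r)
      (h2 : ∀ x, CutVertexOn G A x → StronglyRCutConn r G (A \ {x})) :
      StronglyRCutConn r G A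

namespace ReachIn

variable {V : Type u} {G : SimpleGraph V} {A A' : Set V} {a b c : V}

theorem left_mem (h : ReachIn G A a b) : a ∈ A := h.1

theorem right_mem (h : ReachIn G A a b) : b ∈ A := h.2.1

theorem refl (ha : a ∈ A) : ReachIn G A a a := ⟨ha, ha, Reachable.refl _⟩

theorem symm (h : ReachIn G A a b) : ReachIn G A b a := by
  obtain ⟨ha, hb, h⟩ := h
  exact ⟨hb, ha, h.symm⟩

theorem trans (h : ReachIn G A a b) (h' : ReachIn G A b c) : ReachIn G A a c := by
  obtain ⟨ha, hb, h⟩ := h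
  obtain ⟨_, hc, h'⟩ := h'
  exact ⟨ha, hc, h.trans h'⟩

theorem of_adj (ha : a ∈ A) (hb : b ∈ A) (h : G.Adj a b) : ReachIn G A a b :=
  ⟨ha, hb, Adj.reachable (by simpa using h)⟩

theorem tail (h : ReachIn G A a b) (hc : c ∈ A) (hbc : G.Adj b c) : ReachIn G A a c :=
  h.trans (of_adj h.right_mem hc hbc)

/-- Induction along a path of `G[A]` starting at `a`. -/
theorem induct {P : V → Prop} (h : ReachIn G A a b) (h0 : P a)
    (hs : ∀ c d, c ∈ A → d ∈ A → G.Adj c d → P c → P d) : P b := by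
  obtain ⟨ha, hb, h⟩ := h
  rw [reachable_iff_reflTransGen] at h
  have key : ∀ z : A, Relation.ReflTransGen (G.induce A).Adj ⟨a, ha⟩ z → P z := by
    intro z hz
    induction hz with
    | refl => exact h0
    | @tail x y _ hxy ih => exact hs x y x.2 y.2 (by simpa using hxy) ih
  exact key _ h

theorem mono (hAA : A ⊆ A') (h : ReachIn G A a b) : ReachIn G A' a b :=
  h.induct (P := fun z => ReachIn G A' a z) (refl (hAA h.left_mem))
    fun _ _ _ hd hcd ih => ih.tail (hAA hd) hcd

/-- A path that starts in a set `S` which it cannot leave stays in `S`. -/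
theorem inter_of_closed {S : Set V} (h : ReachIn G A a b) (ha : a ∈ S)
    (hS : ∀ c d, c ∈ A → d ∈ A → G.Adj c d → c ∈ S → d ∈ S) : ReachIn G (A ∩ S) a b :=
  h.induct (P := fun z => ReachIn G (A ∩ S) a z) (refl ⟨h.left_mem, ha⟩)
    fun c d hc hd hcd ih => ih.tail ⟨hd, hS c d hc hd hcd ih.right_mem.2⟩ hcd

/-- A path from outside `B` into `B` has a first vertex in `B`. -/
theorem exists_first_mem {B : Set V} (h : ReachIn G A a b) (ha : a ∉ B) (hb : b ∈ B) :
    ∃ c d, ReachIn G (A \ B) a c ∧ G.Adj c d ∧ d ∈ A ∧ d ∈ B := by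
  by_contra! hcon
  have := h.inter_of_closed (S := {z | ReachIn G (A \ B) a z}) (refl ⟨h.left_mem, ha⟩)
    (fun c d _ hd hcd hc => hc.tail ⟨hd, hcon c d hc hcd hd⟩ hcd)
  exact this.right_mem.2.right_mem.2 hb

/-- The path from `a` only uses vertices reachable from `a`. -/
theorem component (h : ReachIn G A a b) : ReachIn G {z | ReachIn G A a z} a b :=
  (h.inter_of_closed (S := {z | ReachIn G A a z}) (refl h.left_mem)
    fun _ _ _ hd hcd hc => hc.tail hd hcd).mono Set.inter_subset_right

end ReachIn

section CutVertices

variable {V : Type u} {G : SimpleGraph V} {A : Set V}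

/-- The vertex `s` has two neighbours in different connected components of `G[A]`. -/
def Splits (G : SimpleGraph V) (A : Set V) (s : V) : Prop :=
  ∃ p ∈ A, ∃ q ∈ A, G.Adj s p ∧ G.Adj s q ∧ ¬ ReachIn G A p q

theorem reachIn_coe_iff {a b : A} : ReachIn G A a b ↔ (G.induce A).Reachable a b :=
  ⟨fun ⟨_, _, h⟩ => h, fun h => ⟨a.2, b.2, h⟩⟩

theorem induce_preconnected_iff :
    (G.induce A).Preconnected ↔ ∀ a ∈ A, ∀ b ∈ A, ReachIn G A a b :=
  ⟨fun h _ ha _ hb => ⟨ha, hb, h _ _⟩, fun h a b => reachIn_coe_iff.1 (h a a.2 b b.2)⟩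

theorem induce_connected_iff :
    (G.induce A).Connected ↔ A.Nonempty ∧ ∀ a ∈ A, ∀ b ∈ A, ReachIn G A a b := by
  rw [connected_iff, induce_preconnected_iff, Set.nonempty_coe_sort, and_comm]

theorem ReachIn.of_connected (h : G.Connected) (a b : V) : ReachIn G Set.univ a b := by
  refine ⟨trivial, trivial, ?_⟩
  exact (h.preconnected a b).map (induceUnivIso G).symm.toHom

theorem cutVertexOn_iff [Finite V] {x : V} :
    CutVertexOn G A x ↔ x ∈ A ∧ Splits G (A \ {x}) x := by
  have hsub : A \ {x} ⊆ A := Set.sdiff_subset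
  let f : (G.induce (A \ {x})).ConnectedComponent → (G.induce A).ConnectedComponent :=
    ConnectedComponent.map (G.induceHomOfLE hsub).toHom
  have hf : ∀ a b : ↥(A \ {x}), f ((G.induce _).connectedComponentMk a) =
      f ((G.induce _).connectedComponentMk b) ↔ ReachIn G A a b := by
    intro a b
    simp only [f, ConnectedComponent.map_mk, ConnectedComponent.eq, ← reachIn_coe_iff]
    rfl
  refine and_congr_right fun hx => ⟨fun hlt => ?_, ?_⟩
  · by_contra hcon
    simp only [Splits, not_exists, not_and, not_not] at hcon
    refine absurd hlt (not_lt.2 (Nat.card_le_card_of_injective f ?_))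
    intro C D
    refine ConnectedComponent.ind₂ (fun a b hab => ?_) C D
    rw [hf] at hab
    rw [ConnectedComponent.eq, ← reachIn_coe_iff]
    by_cases hax : ReachIn G A a x
    · obtain ⟨c, d, hac, hcd, -, hd⟩ := hax.exists_first_mem (B := {x}) a.2.2 rfl
      obtain ⟨c', d', hac', hcd', -, hd'⟩ :=
        (hab.symm.trans hax).exists_first_mem (B := {x}) b.2.2 rfl
      obtain rfl : d = x := hd
      obtain rfl : d' = d := hd'
      exact (hac.trans (hcon c hac.right_mem c' hac'.right_mem hcd.symm hcd'.symm)).trans hac'.symm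
    · by_contra hab'
      refine hab' ((hab.inter_of_closed (S := {z | ReachIn G (A \ {x}) a z})
        (ReachIn.refl a.2) fun c d _ hd hcd hc => hc.tail ⟨hd, ?_⟩ hcd).right_mem.2)
      rintro rfl
      exact hax ((hc.mono hsub).tail hd hcd)
  · rintro ⟨p, hp, q, hq, hxp, hxq, hpq⟩
    have hsurj : Function.Surjective f := by
      intro C
      refine ConnectedComponent.ind (fun a => ?_) C
      by_cases ha : (a : V) = x
      · refine ⟨(G.induce _).connectedComponentMk ⟨p, hp⟩, ?_⟩
        simp only [f, ConnectedComponent.map_mk, ConnectedComponent.eq, ← reachIn_coe_iff]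
        exact ReachIn.of_adj hp.1 a.2 (ha ▸ hxp.symm)
      · exact ⟨(G.induce _).connectedComponentMk ⟨a, a.2, ha⟩, rfl⟩
    refine lt_of_le_of_ne (Nat.card_le_card_of_surjective f hsurj) fun heq => hpq ?_
    have hinj : Function.Injective f :=
      ((Nat.bijective_iff_surjective_and_card f).2 ⟨hsurj, heq.symm⟩).1
    have := hinj ((hf ⟨p, hp⟩ ⟨q, hq⟩).2
      ((ReachIn.of_adj hp.1 hx hxp.symm).tail hq.1 hxq))
    rw [ConnectedComponent.eq, ← reachIn_coe_iff] at this
    exact this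

theorem cutsetOn_iff [Finite V] [DecidableEq V] {T : Finset V} :
    CutsetOn G A T ↔ ↑T ⊆ A ∧ ∀ t ∈ T, Splits G (A \ ↑T) t := by
  refine and_congr_right fun hTA => forall₂_congr fun t ht => ?_
  have h : (A \ ↑(T.erase t)) \ {t} = A \ ↑T := by
    ext z
    by_cases hz : z = t <;> simp [hz, ht]
  rw [cutVertexOn_iff, h]
  exact and_iff_right ⟨hTA ht, by simp⟩

theorem cutsetOn_univ_iff [Finite V] [DecidableEq V] {T : Finset V} :
    CutsetOn G Set.univ T ↔ ∀ t ∈ T, Splits G (↑T)ᶜ t := by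
  rw [cutsetOn_iff, Set.compl_eq_univ_sdiff]
  simp

/-- Deleting a vertex that is not a cut vertex keeps a connected graph connected. -/
theorem reachIn_diff_of_not_cutVertexOn [Finite V] (hA : ∀ a ∈ A, ∀ b ∈ A, ReachIn G A a b)
    {x : V} (hx : ¬ CutVertexOn G A x) {p q : V} (hp : p ∈ A \ {x}) (hq : q ∈ A \ {x}) :
    ReachIn G (A \ {x}) p q := by
  by_cases hxA : x ∈ A
  · rw [cutVertexOn_iff] at hx
    simp only [hxA, true_and, Splits, not_exists, not_and, not_not] at hx
    obtain ⟨c, d, hc, hcd, -, rfl⟩ := (hA p hp.1 x hxA).exists_first_mem (B := {x}) hp.2 rfl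
    obtain ⟨c', d', hc', hcd', -, hd⟩ := (hA q hq.1 d hxA).exists_first_mem (B := {d}) hq.2 rfl
    obtain rfl : d' = d := hd
    exact (hc.trans (hx c hc.right_mem c' hc'.right_mem hcd.symm hcd'.symm)).trans hc'.symm
  · rw [Set.sdiff_singleton_eq_self hxA]
    exact hA p hp.1 q hq.1

end CutVertices

section Components

variable {V : Type u} {G : SimpleGraph V}

theorem cComp_eq_one {A : Set V} (hA : (G.induce A).Connected) : cComp G A = 1 := by
  have := hA.nonempty
  have : Subsingleton (G.induce A).ConnectedComponent :=
    hA.preconnected.subsingleton_connectedComponent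
  exact Nat.card_of_subsingleton ((G.induce A).connectedComponentMk (Classical.arbitrary _))

/-- The number of components is additive over vertex sets without edges between them. -/
theorem cComp_union [Finite V] {X Y : Set V} (hXY : Disjoint X Y)
    (hE : ∀ x ∈ X, ∀ y ∈ Y, ¬ G.Adj x y) : cComp G (X ∪ Y) = cComp G X + cComp G Y := by
  let f : (G.induce X).ConnectedComponent ⊕ (G.induce Y).ConnectedComponent →
      (G.induce (X ∪ Y)).ConnectedComponent :=
    Sum.elim (ConnectedComponent.map (G.induceHomOfLE Set.subset_union_left).toHom)
      (ConnectedComponent.map (G.induceHomOfLE Set.subset_union_right).toHom)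
  have hX : ∀ a b, ReachIn G (X ∪ Y) a b → a ∈ X → ReachIn G X a b := fun a b h ha =>
    (h.inter_of_closed ha fun c d _ hd hcd hc => hd.resolve_right
      fun hd' => hE c hc d hd' hcd).mono Set.inter_subset_right
  have hY : ∀ a b, ReachIn G (X ∪ Y) a b → a ∈ Y → ReachIn G Y a b := fun a b h ha =>
    (h.inter_of_closed ha fun c d _ hd hcd hc => hd.resolve_left
      fun hd' => hE d hd' c hc hcd.symm).mono Set.inter_subset_right
  rw [cComp, cComp, cComp, ← Nat.card_sum]
  refine (Nat.card_eq_of_bijective f ⟨?_, ?_⟩).symm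
  · rintro (C | C) (D | D) hab <;> induction C using ConnectedComponent.ind with | _ a <;>
      induction D using ConnectedComponent.ind with | _ b <;>
      simp only [f, Sum.elim_inl, Sum.elim_inr, ConnectedComponent.map_mk, ConnectedComponent.eq,
        ← reachIn_coe_iff] at hab
    · rw [ConnectedComponent.eq.2 (reachIn_coe_iff.1 (hX a b hab a.2))]
    · exact absurd b.2 (Set.disjoint_left.1 hXY (hX a b hab a.2).right_mem)
    · exact absurd (hY a b hab a.2).right_mem (Set.disjoint_left.1 hXY b.2)
    · rw [ConnectedComponent.eq.2 (reachIn_coe_iff.1 (hY a b hab a.2))]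
  · intro C
    refine ConnectedComponent.ind (fun a => ?_) C
    obtain ⟨a, ha | ha⟩ := a
    · exact ⟨Sum.inl ((G.induce X).connectedComponentMk ⟨a, ha⟩), rfl⟩
    · exact ⟨Sum.inr ((G.induce Y).connectedComponentMk ⟨a, ha⟩), rfl⟩

end Components

section Blocks

variable {V : Type u} {G : SimpleGraph V} {B : Set V}

theorem ReachIn.component_preconnected {A : Set V} {a p q : V} (hp : ReachIn G A a p)
    (hq : ReachIn G A a q) : ReachIn G {z | ReachIn G A a z} p q :=
  hp.component.symm.trans hq.component

theorem IsBlock.reachIn (hB : IsBlock G B) {a b : V} (ha : a ∈ B) (hb : b ∈ B) :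
    ReachIn G B a b :=
  (induce_connected_iff.1 hB.1).2 a ha b hb

theorem IsBlock.reachIn_diff [Finite V] (hB : IsBlock G B) {x a b : V} (ha : a ∈ B \ {x})
    (hb : b ∈ B \ {x}) : ReachIn G (B \ {x}) a b :=
  reachIn_diff_of_not_cutVertexOn (fun _ h _ h' => hB.reachIn h h') (hB.2.1 x) ha hb

theorem exists_isBlock_of_adj [Finite V] {v u : V} (h : G.Adj v u) :
    ∃ B, IsBlock G B ∧ v ∈ B ∧ u ∈ B := by
  have h0 : (G.induce {v, u}).Connected ∧ ∀ x, ¬ CutVertexOn G {v, u} x := by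
    have hvu : ReachIn G {v, u} v u := ReachIn.of_adj (by simp) (by simp) h
    refine ⟨induce_connected_iff.2 ⟨⟨v, by simp⟩, ?_⟩, fun x hx => ?_⟩
    · rintro a (rfl | rfl) b (rfl | rfl)
      exacts [ReachIn.refl (by simp), hvu, hvu.symm, ReachIn.refl (by simp)]
    · obtain ⟨hx, p, hp, q, hq, -, -, hpq⟩ := cutVertexOn_iff.1 hx
      have : p = q := by
        simp only [Set.mem_sdiff, Set.mem_insert_iff, Set.mem_singleton_iff] at hx hp hq
        grind
      exact hpq (this ▸ ReachIn.refl hp)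
  obtain ⟨B, hle, hmax⟩ := (Set.toFinite
    {B : Set V | (G.induce B).Connected ∧ ∀ x, ¬ CutVertexOn G B x}).exists_le_maximal h0
  exact ⟨B, ⟨hmax.1.1, hmax.1.2, fun B' h1 h2 h3 => (hmax.eq_of_subset ⟨h2, h3⟩ h1).symm⟩,
    hle (by simp), hle (by simp)⟩

/-- A connected set disjoint from a block is attached to at most one vertex of the block. -/
theorem IsBlock.eq_of_attached [Finite V] (hB : IsBlock G B) {K : Set V}
    (hK : ∀ p ∈ K, ∀ q ∈ K, ReachIn G K p q) (hKB : Disjoint K B) {a b k l : V}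
    (ha : a ∈ B) (hb : b ∈ B) (hk : k ∈ K) (hl : l ∈ K) (hka : G.Adj k a) (hlb : G.Adj l b) :
    a = b := by
  induction hn : K.ncard using Nat.strong_induction_on generalizing K with
  | _ n ih =>
  subst hn
  by_contra hab
  have hdis := Set.disjoint_left.1 hKB
  have hBB : B ⊆ B ∪ K := Set.subset_union_left
  have hKK : K ⊆ B ∪ K := Set.subset_union_right
  have hconn : ∀ z ∈ B ∪ K, ReachIn G (B ∪ K) z a := by
    rintro z (hz | hz)
    · exact (hB.reachIn hz ha).mono hBB
    · exact ((hK z hz k hk).mono hKK).tail (hBB ha) hka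
  have hnocut : ∀ x, ¬ CutVertexOn G (B ∪ K) x := by
    intro x hx
    obtain ⟨hx, p, hp, q, hq, -, -, hpq⟩ := cutVertexOn_iff.1 hx
    suffices ∃ c, ∀ z ∈ (B ∪ K) \ {x}, ReachIn G ((B ∪ K) \ {x}) z c by
      obtain ⟨c, hc⟩ := this
      exact hpq ((hc p hp).trans (hc q hq).symm)
    have hBx : B \ {x} ⊆ (B ∪ K) \ {x} := Set.sdiff_subset_sdiff_left hBB
    have hKx : K \ {x} ⊆ (B ∪ K) \ {x} := Set.sdiff_subset_sdiff_left hKK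
    by_cases hxB : x ∈ B
    · have hxK : x ∉ K := fun h => hdis h hxB
      obtain ⟨c, m, hc, hm, hmc, hcx⟩ : ∃ c m, c ∈ B ∧ m ∈ K ∧ G.Adj m c ∧ c ≠ x := by
        by_cases hax : a = x
        · exact ⟨b, l, hb, hl, hlb, fun h => hab (hax.trans h.symm)⟩
        · exact ⟨a, k, ha, hk, hka, hax⟩
      refine ⟨c, fun z ⟨hz, hzx⟩ => ?_⟩
      rcases hz with hz | hz
      · exact (hB.reachIn_diff ⟨hz, hzx⟩ ⟨hc, hcx⟩).mono hBx
      · rw [Set.sdiff_singleton_eq_self hxK] at hKx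
        exact ((hK z hz m hm).mono hKx).tail (hBx ⟨hc, hcx⟩) hmc
    · have hxK : x ∈ K := hx.resolve_left hxB
      have hBx' : B ⊆ (B ∪ K) \ {x} := fun z hz => ⟨Or.inl hz, fun h => hxB (h ▸ hz)⟩
      refine ⟨a, fun z ⟨hz, hzx⟩ => ?_⟩
      rcases hz with hz | hz
      · exact (hB.reachIn hz ha).mono hBx'
      obtain ⟨m, d, hzm, hd, hmd⟩ : ∃ m d, ReachIn G (K \ {x}) z m ∧ d ∈ B ∧ G.Adj m d := by
        by_contra! hcon
        let K' : Set V := {y | y ∈ K ∧ ¬ ReachIn G (K \ {x}) z y}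
        have hK'K : K' ⊆ K := fun y hy => hy.1
        have hx' : x ∈ K' := ⟨hxK, fun h => h.right_mem.2 rfl⟩
        have hto : ∀ y ∈ K', ReachIn G K' y x := by
          intro y hy
          by_cases hyx : y = x
          · exact hyx ▸ ReachIn.refl hy
          obtain ⟨c, d, hyc, hcd, -, rfl⟩ := (hK y hy.1 x hxK).exists_first_mem (B := {x}) hyx rfl
          exact ReachIn.tail (A := K') (hyc.component.mono fun w hw =>
            ⟨hw.right_mem.1, fun hzw => hy.2 (hzw.trans hw.symm)⟩) hx' hcd
        refine hab (ih K'.ncard (Set.ncard_lt_ncard ⟨hK'K, fun h => ?_⟩)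
          (fun p hp q hq => (hto p hp).trans (hto q hq).symm) (hKB.mono_left hK'K)
          ⟨hk, fun h => hcon _ _ h ha hka⟩ ⟨hl, fun h => hcon _ _ h hb hlb⟩ rfl)
        exact (h hz).2 (ReachIn.refl ⟨hz, hzx⟩)
      exact ((hzm.mono hKx).tail (hBx' hd) hmd).trans ((hB.reachIn hd ha).mono hBx')
  have hBK := hB.2.2 (B ∪ K) hBB (induce_connected_iff.2 ⟨⟨a, hBB ha⟩,
    fun p hp q hq => (hconn p hp).trans (hconn q hq).symm⟩) hnocut
  exact hdis hk (hBK ▸ hKK hk)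

/-- A neighbour of `t ∈ B` on the same side of `t` as the rest of the block `B` lies in `B`. -/
theorem IsBlock.mem_of_adj [Finite V] (hB : IsBlock G B) {t a b : V} (ht : t ∈ B)
    (hta : G.Adj t a) (hb : b ∈ B) (hab : ReachIn G {t}ᶜ a b) : a ∈ B := by
  by_contra ha
  obtain ⟨c, d, hac, hcd, hdt, hd⟩ := hab.exists_first_mem ha hb
  refine hdt (hB.eq_of_attached (K := {z | ReachIn G ({t}ᶜ \ B) a z})
    (fun p hp q hq => hp.component_preconnected hq)
    (Set.disjoint_left.2 fun z hz => hz.right_mem.2) hd ht hac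
    (ReachIn.refl hac.left_mem) hcd hta.symm)

/-- A path between two vertices of a block can be taken inside the block. -/
theorem IsBlock.reachIn_inter [Finite V] (hB : IsBlock G B) {A : Set V} {p q : V} (hp : p ∈ B)
    (hq : q ∈ B) (h : ReachIn G A p q) : ReachIn G (A ∩ B) p q := by
  suffices ∃ p', ReachIn G (A ∩ B) p p' ∧
      (q = p' ∨ q ∉ B ∧ ∃ c, ReachIn G (A \ B) q c ∧ G.Adj c p') by
    obtain ⟨p', hp', rfl | ⟨hqB, -⟩⟩ := this
    exacts [hp', absurd hq hqB]
  refine h.induct (P := fun z => ∃ p', ReachIn G (A ∩ B) p p' ∧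
      (z = p' ∨ z ∉ B ∧ ∃ c, ReachIn G (A \ B) z c ∧ G.Adj c p'))
    ⟨p, ReachIn.refl ⟨h.left_mem, hp⟩, Or.inl rfl⟩ ?_
  rintro z w hz hw hzw ⟨p', hp', rfl | ⟨hzB, c, hzc, hcp⟩⟩
  · by_cases hwB : w ∈ B
    · exact ⟨w, hp'.tail ⟨hw, hwB⟩ hzw, Or.inl rfl⟩
    · exact ⟨z, hp', Or.inr ⟨hwB, w, ReachIn.refl ⟨hw, hwB⟩, hzw.symm⟩⟩
  · by_cases hwB : w ∈ B
    · refine ⟨p', hp', Or.inl (hB.eq_of_attached (K := {y | ReachIn G (A \ B) z y})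
        (fun p hp q hq => hp.component_preconnected hq)
        (Set.disjoint_left.2 fun z hz => hz.right_mem.2) hwB hp'.right_mem.2
        (ReachIn.refl hzc.left_mem) hzc hzw hcp)⟩
    · exact ⟨p', hp', Or.inr ⟨hwB, c,
        (ReachIn.of_adj (A := A \ B) ⟨hw, hwB⟩ hzc.left_mem hzw.symm).trans hzc, hcp⟩⟩

end Blocks

section Unmixed

variable {V : Type u} {G : SimpleGraph V}

theorem cComp_univ (hconn : G.Connected) : cComp G Set.univ = 1 := by
  obtain ⟨v⟩ := hconn.nonempty
  exact cComp_eq_one (induce_connected_iff.2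
    ⟨⟨v, trivial⟩, fun a _ b _ => ReachIn.of_connected hconn a b⟩)

variable [Finite V] [DecidableEq V]

/-- In a connected unmixed graph, a vertex `v` of a cutset `T` has a neighbour outside `T` in
every connected component of `G ∖ {v}`. -/
theorem exists_adj_notMem_of_unmixedOn (hconn : G.Connected) (hunm : UnmixedOn G Set.univ)
    {T : Finset V} (hT : CutsetOn G Set.univ T) {v x : V} (hv : v ∈ T) (hx : x ≠ v) :
    ∃ w ∉ T, G.Adj v w ∧ ReachIn G {v}ᶜ x w := by
  classical
  by_contra! hcon
  have hone := cComp_univ hconn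
  let C : Set V := {z | ReachIn G {v}ᶜ x z}
  have hC : ∀ c d, c ∈ C → d ≠ v → G.Adj c d → d ∈ C := fun c d hc hd hcd =>
    ReachIn.tail hc hd hcd
  have hvC : v ∉ C := fun h => ReachIn.right_mem h rfl
  have hcon' : ∀ w ∈ C, w ∉ T → ¬ G.Adj w v := fun w hwC hwT hwv => hcon w hwT hwv.symm hwC
  let T₁ := T.filter (· ∈ C)
  let T₂ := T.filter (· ∉ C)
  have hcard : T₁.card + T₂.card = T.card := Finset.card_filter_add_card_filter_not _
  have hT₁ : CutsetOn G Set.univ T₁ := by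
    rw [cutsetOn_univ_iff] at hT ⊢
    intro s hs
    obtain ⟨hsT, hsC⟩ := Finset.mem_filter.1 hs
    obtain ⟨p, hp, q, hq, hsp, hsq, hpq⟩ := hT s hsT
    have hsub : (↑T : Set V)ᶜ ⊆ (↑T₁)ᶜ := fun z hz h => hz (Finset.filter_subset _ _ h)
    refine ⟨p, hsub hp, q, hsub hq, hsp, hsq, fun h => hpq ?_⟩
    refine (h.inter_of_closed (S := C \ ↑T) ⟨hC s p hsC ?_ hsp, hp⟩ ?_).mono
      fun z hz => hz.2.2
    · rintro rfl
      exact hp hv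
    · rintro c d hc hd hcd ⟨hcC, hcT⟩
      have hdC : d ∈ C := hC c d hcC (fun h => hcon' c hcC hcT (h ▸ hcd)) hcd
      exact ⟨hdC, fun hdT => hd (Finset.mem_filter.2 ⟨hdT, hdC⟩)⟩
  have hT₂ : CutsetOn G Set.univ T₂ := by
    rw [cutsetOn_univ_iff] at hT ⊢
    intro s hs
    obtain ⟨hsT, hsC⟩ := Finset.mem_filter.1 hs
    obtain ⟨p, hp, q, hq, hsp, hsq, hpq⟩ := hT s hsT
    have hsub : (↑T : Set V)ᶜ ⊆ (↑T₂)ᶜ := fun z hz h => hz (Finset.filter_subset _ _ h)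
    refine ⟨p, hsub hp, q, hsub hq, hsp, hsq, fun h => hpq ?_⟩
    refine (h.inter_of_closed (S := Cᶜ) (fun hpC => ?_) ?_).mono
      fun z hz hzT => hz.1 (Finset.mem_filter.2 ⟨hzT, hz.2⟩)
    · by_cases hsv : s = v
      · exact hcon' p hpC hp (hsv ▸ hsp.symm)
      · exact hsC (hC p s hpC hsv hsp.symm)
    · intro c d hc hd hcd hcC hdC
      refine hcC (hC d c hdC (fun h => hc ?_) hcd.symm)
      exact Finset.mem_filter.2 ⟨h ▸ hv, hcC⟩
  have hcompC : cComp G C = 1 := cComp_eq_one (induce_connected_iff.2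
    ⟨⟨x, ReachIn.refl hx⟩, fun p hp q hq => ReachIn.component_preconnected hp hq⟩)
  have hcompC' : cComp G Cᶜ = 1 := by
    have hto : ∀ z ∈ Cᶜ, ReachIn G Cᶜ z v := by
      intro z hz
      by_cases hzv : z = v
      · exact hzv ▸ ReachIn.refl hz
      obtain ⟨c, d, hzc, hcd, -, rfl⟩ :=
        (ReachIn.of_connected hconn z v).exists_first_mem (B := {v}) hzv rfl
      refine ReachIn.tail (A := Cᶜ) (hzc.component.mono fun w hw hwC => hz ?_) hvC hcd
      exact ReachIn.trans hwC (hw.symm.mono fun y hy => hy.2)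
    exact cComp_eq_one (induce_connected_iff.2
      ⟨⟨v, hvC⟩, fun p hp q hq => (hto p hp).trans (hto q hq).symm⟩)
  have hdisj : Disjoint C Cᶜ := disjoint_compl_right
  have e : cComp G (Set.univ \ ↑T) = cComp G (C \ ↑T) + cComp G (Cᶜ \ ↑T) := by
    rw [← cComp_union (hdisj.mono Set.sdiff_subset Set.sdiff_subset)]
    · congr 1
      ext z
      by_cases hz : z ∈ C <;> simp [hz]
    · exact fun c hc d hd hcd => hd.1 (hC c d hc.1 (fun h => hd.2 (h ▸ hv)) hcd)
  have e₁ : cComp G (Set.univ \ ↑T₁) = cComp G (C \ ↑T) + cComp G Cᶜ := by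
    rw [← cComp_union (hdisj.mono_left Set.sdiff_subset)]
    · congr 1
      ext z
      by_cases hz : z ∈ C <;> simp [hz, T₁]
    · exact fun c hc d hd hcd => hd (hC c d hc.1 (fun h => hcon' c hc.1 hc.2 (h ▸ hcd)) hcd)
  have e₂ : cComp G (Set.univ \ ↑T₂) = cComp G C + cComp G (Cᶜ \ ↑T) := by
    rw [← cComp_union (hdisj.mono_right Set.sdiff_subset)]
    · congr 1
      ext z
      by_cases hz : z ∈ C <;> simp [hz, T₂]
    · exact fun c hc d hd hcd => hd.1 (hC c d hc (fun h => hd.2 (h ▸ hv)) hcd)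
  have h := hunm T hT
  have h₁ := hunm T₁ hT₁
  have h₂ := hunm T₂ hT₂
  omega

/-- In a connected unmixed graph, deleting a vertex leaves at most two components. -/
theorem reachIn_or_of_unmixedOn (hconn : G.Connected) (hunm : UnmixedOn G Set.univ)
    {t a b c : V} (hb : b ≠ t) (hc : c ≠ t) (ht : CutVertexOn G Set.univ t)
    (hab : ¬ ReachIn G {t}ᶜ a b) (ha : a ≠ t) : ReachIn G {t}ᶜ a c ∨ ReachIn G {t}ᶜ b c := by
  have hcut : CutsetOn G Set.univ {t} := by
    rw [cutsetOn_iff]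
    simpa using (cutVertexOn_iff.1 ht).2
  have h2 := hunm _ hcut
  rw [cComp_univ hconn, Finset.coe_singleton, ← Set.compl_eq_univ_sdiff, Finset.card_singleton,
    cComp, Nat.card_eq_two_iff] at h2
  obtain ⟨x, y, -, hxy⟩ := h2
  have hmem : ∀ z (hz : z ≠ t), (G.induce {t}ᶜ).connectedComponentMk ⟨z, hz⟩ = x ∨
      (G.induce {t}ᶜ).connectedComponentMk ⟨z, hz⟩ = y := fun z hz => by
    have := Set.mem_univ ((G.induce {t}ᶜ).connectedComponentMk ⟨z, hz⟩)
    rwa [← hxy] at this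
  have hr : ∀ z w (hz : z ≠ t) (hw : w ≠ t), ReachIn G {t}ᶜ z w ↔
      (G.induce {t}ᶜ).connectedComponentMk ⟨z, hz⟩ =
        (G.induce {t}ᶜ).connectedComponentMk ⟨w, hw⟩ := fun z w hz hw => by
    rw [ConnectedComponent.eq, ← reachIn_coe_iff]
  rw [hr a b ha hb] at hab
  rw [hr a c ha hc, hr b c hb hc]
  have h1 := hmem a ha
  have h2 := hmem b hb
  have h3 := hmem c hc
  grind

end Unmixed

section Whiskers

variable {V : Type u} {G : SimpleGraph V} {C : Set V}

@[simp]
theorem whiskered_adj_inl_inl {a b : V} :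
    (whiskered G C).Adj (Sum.inl a) (Sum.inl b) ↔ G.Adj a b := by
  have := G.adj_comm a b
  have h : G.Adj a b → a ≠ b := fun h => h.ne
  simp [whiskered]
  tauto

@[simp]
theorem whiskered_adj_inl_inr {a b : V} :
    (whiskered G C).Adj (Sum.inl a) (Sum.inr b) ↔ a ∈ C ∧ b = a := by
  simp only [whiskered, fromRel_adj]
  grind

@[simp]
theorem whiskered_adj_inr_inl {a b : V} :
    (whiskered G C).Adj (Sum.inr b) (Sum.inl a) ↔ a ∈ C ∧ b = a := by
  rw [adj_comm, whiskered_adj_inl_inr]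

@[simp]
theorem not_whiskered_adj_inr_inr {a b : V} :
    ¬ (whiskered G C).Adj (Sum.inr a) (Sum.inr b) := by
  simp [whiskered]

variable {B S : Set V}

theorem reachIn_whiskered_iff {p q : V} :
    ReachIn (whiskered G C) ((Sum.inl '' B ∪ Sum.inr '' C) \ Sum.inl '' S)
        (Sum.inl p) (Sum.inl q) ↔
      ReachIn G (B \ S) p q := by
  constructor
  · intro h
    have hp : p ∈ B \ S := by simpa using h.left_mem
    refine h.induct (P := fun z => ReachIn G (B \ S) p (Sum.elim id id z)) (ReachIn.refl hp) ?_
    rintro (c | c) (d | d) hc hd hcd ih <;> simp at hc hd hcd ih ⊢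
    · exact ih.tail hd hcd
    · exact hcd.2 ▸ ih
    · exact hcd.2 ▸ ih
  · intro h
    exact h.induct (P := fun z => ReachIn (whiskered G C) _ (Sum.inl p) (Sum.inl z))
      (ReachIn.refl (by simpa using h.left_mem))
      fun c d _ hd hcd ih => ih.tail (by simpa using hd) (by simpa using hcd)

theorem splits_whiskered_iff {s : V} (hs : s ∈ S) :
    Splits (whiskered G C) ((Sum.inl '' B ∪ Sum.inr '' C) \ Sum.inl '' S) (Sum.inl s) ↔
      Splits G (B \ S) s ∨ s ∈ C ∧ ∃ w ∈ B \ S, G.Adj s w := by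
  constructor
  · rintro ⟨p | p, hp, q | q, hq, hsp, hsq, hpq⟩
    · rw [reachIn_whiskered_iff] at hpq
      exact Or.inl ⟨p, by simpa using hp, q, by simpa using hq, by simpa using hsp,
        by simpa using hsq, hpq⟩
    · exact Or.inr ⟨(whiskered_adj_inl_inr.1 hsq).1, p, by simpa using hp, by simpa using hsp⟩
    · exact Or.inr ⟨(whiskered_adj_inl_inr.1 hsp).1, q, by simpa using hq, by simpa using hsq⟩
    · rw [whiskered_adj_inl_inr] at hsp hsq
      obtain rfl : p = q := hsp.2.trans hsq.2.symm
      exact absurd (ReachIn.refl hp) hpq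
  · rintro (⟨p, hp, q, hq, hsp, hsq, hpq⟩ | ⟨hsC, w, hw, hsw⟩)
    · exact ⟨Sum.inl p, by simpa using hp, Sum.inl q, by simpa using hq, by simpa using hsp,
        by simpa using hsq, by rwa [reachIn_whiskered_iff]⟩
    · refine ⟨Sum.inr s, by simpa using hsC, Sum.inl w, by simpa using hw, by simpa using hsC,
        by simpa using hsw, fun h => ?_⟩
      have : Sum.inl w = (Sum.inr s : V ⊕ V) := by
        refine h.induct (P := fun z => z = Sum.inr s) rfl ?_
        rintro c (d | d) hc hd hcd rfl
        · obtain ⟨-, rfl⟩ := whiskered_adj_inr_inl.1 hcd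
          exact absurd ⟨s, hs, rfl⟩ hd.2
        · exact absurd hcd not_whiskered_adj_inr_inr
      cases this

theorem cutsetOn_whiskered_iff [Finite V] [DecidableEq V] {S : Finset V}
    (hSB : ↑S ⊆ B) :
    CutsetOn (whiskered G C) (Sum.inl '' B ∪ Sum.inr '' C) (S.map Function.Embedding.inl) ↔
      ∀ s ∈ S, Splits G (B \ ↑S) s ∨ s ∈ C ∧ ∃ w ∈ B \ ↑S, G.Adj s w := by
  have hcoe : ((S.map Function.Embedding.inl : Finset (V ⊕ V)) : Set (V ⊕ V)) =
      Sum.inl '' (↑S : Set V) := by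
    simp
  rw [cutsetOn_iff, hcoe, and_iff_right ((Set.image_mono hSB).trans Set.subset_union_left)]
  simp only [Finset.mem_map, forall_exists_index, and_imp, forall_apply_eq_imp_iff₂,
    Function.Embedding.inl_apply]
  exact forall₂_congr fun s hs => splits_whiskered_iff hs

end Whiskers

section Accessible

variable {V : Type u} [DecidableEq V] {G : SimpleGraph V} {B : Set V}

/-- If putting `t` back joins the components of `p` and `q`, then `t` is adjacent to both. -/
theorem exists_adj_of_reachIn_erase {T : Finset V} {t p q : V}
    (hp : p ∉ T) (h : ReachIn G (↑(T.erase t))ᶜ p q) (hpq : ¬ ReachIn G (↑T)ᶜ p q) :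
    ∃ a, ReachIn G (↑T)ᶜ p a ∧ G.Adj t a := by
  by_contra! hcon
  refine hpq (h.inter_of_closed (S := {z | ReachIn G (↑T)ᶜ p z}) (ReachIn.refl hp) ?_).right_mem.2
  intro c d _ hd hcd hc
  refine ReachIn.tail hc (fun hdT => hd ?_) hcd
  exact Finset.mem_erase.2 ⟨fun hdt => hcon c hc (hdt ▸ hcd.symm), hdT⟩

variable [Finite V]

/-- In an accessible block with whiskers, some vertex `t` can be removed from a cutset `T` so that
the vertices of `T` on the same side of `t` as the block still separate. -/
theorem IsBlock.exists_erase_splits (hconn : G.Connected) (hunm : UnmixedOn G Set.univ)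
    (hB : IsBlock G B)
    (hacc : AccessibleOn (whiskered G {w | w ∈ B ∧ CutVertexOn G Set.univ w})
      (Sum.inl '' B ∪ Sum.inr '' {w | w ∈ B ∧ CutVertexOn G Set.univ w}))
    {T : Finset V} (hT : CutsetOn G Set.univ T) {v u : V} (hv : v ∈ T) (hvB : v ∈ B)
    (huB : u ∈ B) (huv : u ≠ v) :
    ∃ t ∈ T, t ∈ B ∧ ∀ s ∈ T, s ≠ t → ∀ b ∈ B, b ≠ t → ReachIn G {t}ᶜ b s →
      Splits G (↑(T.erase t))ᶜ s := by
  classical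
  have hsplit := cutsetOn_univ_iff.1 hT
  let S := T.filter (· ∈ B)
  have hS : ∀ s, s ∈ S ↔ s ∈ T ∧ s ∈ B := fun s => Finset.mem_filter
  have hSB : (↑S : Set V) ⊆ B := fun s hs => ((hS s).1 hs).2
  have hcut : CutsetOn (whiskered G {w | w ∈ B ∧ CutVertexOn G Set.univ w})
      (Sum.inl '' B ∪ Sum.inr '' {w | w ∈ B ∧ CutVertexOn G Set.univ w})
      (S.map Function.Embedding.inl) := by
    rw [cutsetOn_whiskered_iff hSB]
    intro s hs
    obtain ⟨hsT, hsB⟩ := (hS s).1 hs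
    obtain ⟨b, hb, hbs⟩ : ∃ b ∈ B, b ≠ s := by
      by_cases hvs : v = s
      · exact ⟨u, huB, fun h => huv (h.trans hvs.symm)⟩
      · exact ⟨v, hvB, hvs⟩
    have hTS : ∀ w, w ∉ T → w ∉ S := fun w hw h => hw ((hS w).1 h).1
    by_cases hsc : CutVertexOn G Set.univ s
    · obtain ⟨w, hwT, hsw, hbw⟩ := exists_adj_notMem_of_unmixedOn hconn hunm hT hsT hbs
      exact Or.inr ⟨⟨hsB, hsc⟩, w, ⟨hB.mem_of_adj hsB hsw hb hbw.symm, hTS w hwT⟩, hsw⟩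
    · have hmem : ∀ p, G.Adj s p → p ∈ B := fun p hsp => by
        refine hB.mem_of_adj hsB hsp hb ?_
        rw [Set.compl_eq_univ_sdiff]
        exact reachIn_diff_of_not_cutVertexOn
          (fun a _ b _ => ReachIn.of_connected hconn a b) hsc ⟨trivial, hsp.ne'⟩ ⟨trivial, hbs⟩
      obtain ⟨p, hp, q, hq, hsp, hsq, hpq⟩ := hsplit s hsT
      refine Or.inl ⟨p, ⟨hmem p hsp, hTS p hp⟩, q, ⟨hmem q hsq, hTS q hq⟩, hsp, hsq, fun h => ?_⟩
      exact hpq (h.mono fun z hz hzT => hz.2 ((hS z).2 ⟨hzT, hz.1⟩))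
  obtain ⟨t', ht', hcut'⟩ := hacc.2 _ hcut
    ⟨Sum.inl v, Finset.mem_map.2 ⟨v, (hS v).2 ⟨hv, hvB⟩, rfl⟩⟩
  obtain ⟨t, htS, rfl⟩ := Finset.mem_map.1 ht'
  obtain ⟨htT, htB⟩ := (hS t).1 htS
  rw [← Finset.map_erase, cutsetOn_whiskered_iff
    ((Finset.coe_subset.2 (Finset.erase_subset _ _)).trans hSB)] at hcut'
  refine ⟨t, htT, htB, fun s hsT hst b hb hbt hbs => ?_⟩
  have hsub : B \ ↑(S.erase t) = (↑(T.erase t))ᶜ ∩ B := by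
    ext z
    simp [hS]
    tauto
  by_cases hsB : s ∈ B
  · have := hcut' s (Finset.mem_erase.2 ⟨hst, (hS s).2 ⟨hsT, hsB⟩⟩)
    rw [hsub] at this
    obtain ⟨p, hp, q, hq, hsp, hsq, hpq⟩ | ⟨⟨-, hsc⟩, w, hw, hsw⟩ := this
    · exact ⟨p, hp.1, q, hq.1, hsp, hsq, fun h => hpq (hB.reachIn_inter hp.2 hq.2 h)⟩
    · obtain ⟨x, hxs, hx⟩ : ∃ x, x ≠ s ∧ ¬ ReachIn G {s}ᶜ w x := by
        obtain ⟨-, p, hp, q, hq, -, -, hpq⟩ := cutVertexOn_iff.1 hsc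
        rw [← Set.compl_eq_univ_sdiff] at hpq hp hq
        by_contra! hcon
        exact hpq ((hcon p hp).symm.trans (hcon q hq))
      obtain ⟨w', hwT', hsw', hxw'⟩ := exists_adj_notMem_of_unmixedOn hconn hunm hT hsT hxs
      have hTs : (↑(T.erase t) : Set V)ᶜ ⊆ {s}ᶜ := fun z hz hzs => hz (by
        obtain rfl : z = s := hzs
        exact Finset.mem_erase.2 ⟨hst, hsT⟩)
      exact ⟨w, hw.1, w', fun h => hwT' (Finset.mem_of_mem_erase h), hsw, hsw',
        fun h => hx ((h.mono hTs).trans hxw'.symm)⟩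
  · obtain ⟨p, hp, q, hq, hsp, hsq, hpq⟩ := hsplit s hsT
    have hsub' : (↑T : Set V)ᶜ ⊆ (↑(T.erase t))ᶜ := fun z hz h => hz (Finset.mem_of_mem_erase h)
    refine ⟨p, hsub' hp, q, hsub' hq, hsp, hsq, fun h => ?_⟩
    have hTt : (↑T : Set V)ᶜ ⊆ {t}ᶜ := fun z hz hzt => hz (by
      obtain rfl : z = t := hzt
      exact htT)
    have key : ∀ p a, ReachIn G (↑T)ᶜ p a → G.Adj t a → G.Adj s p →
        ∃ c d, ReachIn G Bᶜ s c ∧ G.Adj c d ∧ d ∈ B ∧ ReachIn G (↑T)ᶜ p d := by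
      intro p a hpa hta hsp
      have haB : a ∈ B := hB.mem_of_adj htB hta hb <|
        ((hpa.symm.mono hTt).tail hst hsp.symm).trans hbs.symm
      have hsa : ReachIn G ({z | ReachIn G (↑T)ᶜ p z} ∪ {s}) s a :=
        ((hpa.component.mono Set.subset_union_left).symm.tail
          (Or.inr (Set.mem_singleton s)) hsp.symm).symm
      obtain ⟨c, d, hsc, hcd, hd, hdB⟩ := hsa.exists_first_mem hsB haB
      refine ⟨c, d, hsc.mono fun z hz => hz.2, hcd, hdB, hd.resolve_right ?_⟩
      rintro rfl
      exact hsB hdB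
    obtain ⟨a, hpa, hta⟩ := exists_adj_of_reachIn_erase hp h hpq
    obtain ⟨a', hqa, hta'⟩ := exists_adj_of_reachIn_erase hq h.symm fun h' => hpq h'.symm
    obtain ⟨c, d, hsc, hcd, hdB, hpd⟩ := key p a hpa hta hsp
    obtain ⟨c', d', hsc', hcd', hdB', hqd⟩ := key q a' hqa hta' hsq
    obtain rfl := hB.eq_of_attached (K := {z | ReachIn G Bᶜ s z})
      (fun p hp q hq => hp.component_preconnected hq)
      (Set.disjoint_left.2 fun z hz => hz.right_mem) hdB hdB' hsc hsc' hcd hcd'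
    exact hpq (hpd.trans hqd.symm)

/-- If the vertices of `T` on the side of `v` still separate after removing `t` from `T`, then
either `T ∖ {t}` is a cutset, or only vertices on one other side of `t` may fail to separate. -/
theorem cutsetOn_erase_or_exists_adj (hconn : G.Connected) (hunm : UnmixedOn G Set.univ)
    {T : Finset V} {t v : V} (hvt : v ≠ t)
    (h : ∀ s ∈ T, s ≠ t → ReachIn G {t}ᶜ v s → Splits G (↑(T.erase t))ᶜ s) :
    CutsetOn G Set.univ (T.erase t) ∨ ∃ u, G.Adj t u ∧ ¬ ReachIn G {t}ᶜ v u ∧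
      ∀ s ∈ T, s ≠ t → ¬ ReachIn G {t}ᶜ u s → Splits G (↑(T.erase t))ᶜ s := by
  by_cases ht : CutVertexOn G Set.univ t
  · right
    obtain ⟨-, p, hp, q, hq, htp, htq, hpq⟩ := cutVertexOn_iff.1 ht
    rw [← Set.compl_eq_univ_sdiff] at hpq
    obtain ⟨u, htu, hvu⟩ : ∃ u, G.Adj t u ∧ ¬ ReachIn G {t}ᶜ v u := by
      by_contra! hcon
      exact hpq ((hcon p htp).symm.trans (hcon q htq))
    refine ⟨u, htu, hvu, fun s hs hst hus => h s hs hst ?_⟩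
    exact (reachIn_or_of_unmixedOn hconn hunm htu.ne' hst ht hvu hvt).resolve_right hus
  · left
    rw [cutsetOn_univ_iff]
    intro s hs
    obtain ⟨hst, hsT⟩ := Finset.mem_erase.1 hs
    refine h s hsT hst ?_
    rw [Set.compl_eq_univ_sdiff]
    exact reachIn_diff_of_not_cutVertexOn
      (fun a _ b _ => ReachIn.of_connected hconn a b) ht ⟨trivial, hvt⟩ ⟨trivial, hst⟩

/-- Moving through the blocks away from `v` finds a removable vertex of a cutset `T`, provided
that `T ∖ {v}` can fail to be a cutset only on the side of `v` containing `u`. -/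
theorem exists_cutsetOn_erase (hconn : G.Connected) (hunm : UnmixedOn G Set.univ)
    (hblocks : ∀ B : Set V, IsBlock G B →
      AccessibleOn (whiskered G {w | w ∈ B ∧ CutVertexOn G Set.univ w})
        (Sum.inl '' B ∪ Sum.inr '' {w | w ∈ B ∧ CutVertexOn G Set.univ w}))
    {T : Finset V} (hT : CutsetOn G Set.univ T) {v u : V} (hv : v ∈ T) (hvu : G.Adj v u)
    (h : ∀ s ∈ T, s ≠ v → ¬ ReachIn G {v}ᶜ u s → Splits G (↑(T.erase v))ᶜ s) :
    ∃ t ∈ T, CutsetOn G Set.univ (T.erase t) := by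
  induction hn : {z | ReachIn G {v}ᶜ u z}.ncard using Nat.strong_induction_on
    generalizing v u with
  | _ n ih =>
  subst hn
  obtain ⟨B, hB, hvB, huB⟩ := exists_isBlock_of_adj hvu
  obtain ⟨t, htT, htB, ht⟩ :=
    hB.exists_erase_splits hconn hunm (hblocks B hB) hT hv hvB huB hvu.ne'
  by_cases htv : t = v
  · subst htv
    refine ⟨t, htT, cutsetOn_univ_iff.2 fun s hs => ?_⟩
    obtain ⟨hst, hsT⟩ := Finset.mem_erase.1 hs
    by_cases hus : ReachIn G {t}ᶜ u s
    · exact ht s hsT hst u huB hvu.ne' hus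
    · exact h s hsT hst hus
  have hvt : v ≠ t := fun h => htv h.symm
  obtain hcut | ⟨w, htw, hvw, hw⟩ := cutsetOn_erase_or_exists_adj hconn hunm hvt
    fun s hs hst hvs => ht s hs hst v hvB hvt hvs
  · exact ⟨t, htT, hcut⟩
  have hut : ReachIn G {v}ᶜ u t :=
    (hB.reachIn_diff ⟨huB, hvu.ne'⟩ ⟨htB, htv⟩).mono fun z hz => hz.2
  refine ih _ (Set.ncard_lt_ncard ⟨fun z hz => ?_, fun hsub => ?_⟩) htT htw hw rfl
  · have hwz : ReachIn G {v}ᶜ w z := (ReachIn.component hz).mono fun y hy hyv => by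
      obtain rfl : y = v := hyv
      exact hvw hy.symm
    exact (hut.tail hwz.left_mem htw).trans hwz
  · exact (hsub hut).right_mem rfl

end Accessible

/-- if `G` is connected, `J_G` is unmixed and for every block `B` of
`G` the block with whiskers `B̄` is accessible, then `G` is accessible. -/
theorem accessible_of_blocks_whiskers {V : Type u} [Fintype V] [DecidableEq V]
    (G : SimpleGraph V) (hconn : G.Connected) (hunm : UnmixedOn G Set.univ)
    (hblocks : ∀ B : Set V, IsBlock G B →
      AccessibleOn (whiskered G {w | w ∈ B ∧ CutVertexOn G Set.univ w})
        (Sum.inl '' B ∪ Sum.inr '' {w | w ∈ B ∧ CutVertexOn G Set.univ w})) :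
    AccessibleOn G Set.univ := by
  refine ⟨hunm, fun T hT ⟨v, hv⟩ => ?_⟩
  obtain ⟨u, -, -, -, hvu, -, -⟩ := cutsetOn_univ_iff.1 hT v hv
  obtain ⟨B, hB, hvB, huB⟩ := exists_isBlock_of_adj hvu
  obtain ⟨t, htT, htB, ht⟩ :=
    hB.exists_erase_splits hconn hunm (hblocks B hB) hT hv hvB huB hvu.ne'
  obtain ⟨b, hb, hbt⟩ : ∃ b ∈ B, b ≠ t := by
    by_cases hvt : v = t
    · exact ⟨u, huB, fun h => hvu.ne (hvt.trans h.symm)⟩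
    · exact ⟨v, hvB, hvt⟩
  obtain hcut | ⟨w, htw, -, hw⟩ := cutsetOn_erase_or_exists_adj hconn hunm hbt
    fun s hs hst hbs => ht s hs hst b hb hbt hbs
  · exact ⟨t, htT, hcut⟩
  · exact exists_cutsetOn_erase hconn hunm hblocks hT htT htw hw
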